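/- Let K be a field, f ∈ K[x] monic separable with roots α_1,…,α_n in a splitting field N, F(z, u) = ∏_{σ ∈ S_n}(z − Σ_i α_{σ(i)} u_i) ∈ K[z, u_1, …, u_n], and F_1 the irreducible factor of F over K divisible over N by z − Σ_i α_i u_i. Then the degree of F_1 in z equals the order of the Galois group of f over K. -/

import Mathlib

open Polynomial

theorem stmt19_aux_ext (K N : Type) [Field K] [Field N] [Algebra K N] (n : ℕ)
    (f : K[X]) (hm : f.Monic)
    [IsSplittingField K N f] (α : Fin n → N)
    (hroots : f.map (algebraMap K N) = ∏ i, (X - C (α i)))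
    (σ τ : N ≃ₐ[K] N) (h : ∀ i, σ (α i) = τ (α i)) : σ = τ := by
  have h1 : (σ : N →ₐ[K] N) = τ := by
    refine AlgHom.ext_of_adjoin_eq_top (IsSplittingField.adjoin_rootSet N f) ?_
    intro x hx
    have hx' := (mem_rootSet.mp hx).2
    rw [aeval_def, ← eval_map, hroots, eval_prod, Finset.prod_eq_zero_iff] at hx'
    obtain ⟨i, -, hi⟩ := hx'
    have : x = α i := by simpa [sub_eq_zero] using hi
    subst this
    exact h i
  ext x
  exact DFunLike.congr_fun h1 x

theorem stmt19_aux_descend (K N : Type) [Field K] [Field N] [Algebra K N] (n : ℕ)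
    [FiniteDimensional K N] [IsGalois K N] (G : Polynomial (MvPolynomial (Fin n) N))
    (h : ∀ τ : N ≃ₐ[K] N, G.map (MvPolynomial.map (τ : N →+* N)) = G) :
    ∃ G₀ : Polynomial (MvPolynomial (Fin n) K),
      G₀.map (MvPolynomial.map (algebraMap K N)) = G := by
  have : G ∈ Polynomial.lifts (MvPolynomial.map (σ := Fin n) (algebraMap K N)) := by
    rw [Polynomial.lifts_iff_coeff_lifts]
    intro k
    have key : ∀ m, ∃ y, algebraMap K N y = (G.coeff k).coeff m := by
      intro m
      have : (G.coeff k).coeff m ∈ (⊥ : IntermediateField K N) := by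
        rw [IsGalois.mem_bot_iff_fixed]
        intro τ
        have h2 := congrArg (fun P => (P.coeff k).coeff m) (h τ)
        simpa [Polynomial.coeff_map, MvPolynomial.coeff_map] using h2
      simpa [IntermediateField.mem_bot] using this
    have := MvPolynomial.mem_range_map_iff_coeffs_subset (f := algebraMap K N) (x := G.coeff k)
    refine this.mpr ?_
    intro y hy
    obtain ⟨m, -, rfl⟩ := MvPolynomial.mem_coeffs_iff.mp hy
    exact key m
  exact (Polynomial.mem_lifts _).mp this

theorem stmt19 (K N : Type) [Field K] [Field N] [Algebra K N] (n : ℕ)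
    (f : K[X]) (hm : f.Monic) (hsep : f.Separable)
    [IsSplittingField K N f] (α : Fin n → N) (hinj : Function.Injective α)
    (hroots : f.map (algebraMap K N) = ∏ i, (X - C (α i)))
    (F₀ F₁ : Polynomial (MvPolynomial (Fin n) K))
    (hF₀ : F₀.map (MvPolynomial.map (algebraMap K N)) =
      ∏ σ : Equiv.Perm (Fin n),
        (X - C (∑ i, MvPolynomial.C (α (σ i)) * MvPolynomial.X i)))
    (hF₁ : Irreducible F₁) (hdvd : F₁ ∣ F₀)
    (hid : (X - C (∑ i, MvPolynomial.C (α i) * MvPolynomial.X i)) ∣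
      F₁.map (MvPolynomial.map (algebraMap K N))) :
    F₁.natDegree = Nat.card (N ≃ₐ[K] N) := by
  classical
  haveI : FiniteDimensional K N := IsSplittingField.finiteDimensional N f
  haveI : IsGalois K N := IsGalois.of_separable_splitting_field hsep
  set φ : MvPolynomial (Fin n) K →+* MvPolynomial (Fin n) N :=
    MvPolynomial.map (algebraMap K N) with hφ
  have hφinj : Function.Injective φ :=
    MvPolynomial.map_injective _ (algebraMap K N).injective
  let l : (N ≃ₐ[K] N) → MvPolynomial (Fin n) N := fun τ =>
    ∑ i, MvPolynomial.C (τ (α i)) * MvPolynomial.X i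
  have hlmap : ∀ σ τ : N ≃ₐ[K] N, MvPolynomial.map (τ : N →+* N) (l σ) = l (τ * σ) := by
    intro σ τ
    simp [l, map_sum]
  have hlinj : Function.Injective l := by
    intro σ τ h
    refine stmt19_aux_ext K N n f hm α hroots σ τ fun i => ?_
    have := congrArg (MvPolynomial.aeval (R := N) (Pi.single i (1 : N))) h
    simpa [l, Pi.single_apply] using this
  have hτφ : ∀ τ : N ≃ₐ[K] N,
      (MvPolynomial.map (τ : N →+* N)).comp φ = φ := by
    intro τ
    ext x <;> simp [hφ]
  have hl1 : l 1 = ∑ i, MvPolynomial.C (α i) * MvPolynomial.X i := by simp [l]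
  rw [← hl1] at hid
  have hne : F₁.map φ ≠ 0 := (Polynomial.map_ne_zero_iff hφinj).mpr hF₁.ne_zero
  rw [Nat.card_eq_fintype_card]
  apply le_antisymm
  · -- upper bound through the minimal polynomial
    obtain ⟨G₀, hG₀⟩ := stmt19_aux_descend K N n (∏ τ, (X - C (l τ))) (by
      intro τ
      rw [Polynomial.map_prod]
      simp only [Polynomial.map_sub, Polynomial.map_X, Polynomial.map_C, hlmap]
      exact Fintype.prod_equiv (Equiv.mulLeft τ) _ _ (fun σ => rfl))
    have hGdeg : G₀.natDegree = Fintype.card (N ≃ₐ[K] N) := by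
      rw [← Polynomial.natDegree_map_eq_of_injective hφinj, hG₀,
        Polynomial.natDegree_prod_of_monic _ _ (fun τ _ => monic_X_sub_C _)]
      simp
    have hGmonic : G₀.Monic := by
      refine Polynomial.monic_of_injective hφinj ?_
      rw [hG₀]
      exact monic_prod_of_monic _ _ (fun τ _ => monic_X_sub_C _)
    letI : Algebra (MvPolynomial (Fin n) K) (MvPolynomial (Fin n) N) := φ.toAlgebra
    haveI : Module.IsTorsionFree (MvPolynomial (Fin n) K) (MvPolynomial (Fin n) N) :=
      Module.isTorsionFree_iff_algebraMap_injective.mpr hφinj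
    have hGz : aeval (l 1) G₀ = 0 := by
      rw [aeval_def, ← eval_map]
      change eval (l 1) (G₀.map φ) = 0
      rw [hG₀, eval_prod]
      exact Finset.prod_eq_zero (Finset.mem_univ 1) (by simp)
    have hFz : aeval (l 1) F₁ = 0 := by
      rw [aeval_def, ← eval_map]
      exact dvd_iff_isRoot.mp hid
    have hint : IsIntegral (MvPolynomial (Fin n) K) (l 1) := ⟨G₀, hGmonic, hGz⟩
    have d1 := minpoly.isIntegrallyClosed_dvd hint hFz
    have d2 := minpoly.isIntegrallyClosed_dvd hint hGz
    have hnu := minpoly.not_isUnit (MvPolynomial (Fin n) K) (l 1)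
    have has : F₁ ∣ minpoly (MvPolynomial (Fin n) K) (l 1) :=
      (hF₁.dvd_iff.mp d1).resolve_left hnu |>.dvd
    rw [← hGdeg]
    exact natDegree_le_of_dvd (has.trans d2) hGmonic.ne_zero
  · have hroot : ∀ τ, l τ ∈ (F₁.map φ).roots := by
      intro τ
      rw [mem_roots hne, ← dvd_iff_isRoot]
      have := Polynomial.map_dvd (MvPolynomial.map (τ : N →+* N)) hid
      rwa [Polynomial.map_map, hτφ, Polynomial.map_sub, Polynomial.map_X, Polynomial.map_C,
        hlmap, mul_one] at this
    calc Fintype.card (N ≃ₐ[K] N) = (Finset.univ.image l).card := by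
          rw [Finset.card_image_of_injective _ hlinj, Finset.card_univ]
      _ ≤ (F₁.map φ).roots.toFinset.card := by
          apply Finset.card_le_card
          intro x hx
          obtain ⟨τ, -, rfl⟩ := Finset.mem_image.mp hx
          exact Multiset.mem_toFinset.mpr (hroot τ)
      _ ≤ (F₁.map φ).roots.card := Multiset.toFinset_card_le _
      _ ≤ (F₁.map φ).natDegree := card_roots' _
      _ = F₁.natDegree := Polynomial.natDegree_map_eq_of_injective hφinj _
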